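/- Soundness of wlp: let (M,·,1) be a monoid and let S be a naturally ordered ω-bicontinuous M-module. Then for every M-wGCL program C and every state σ, wlp[C](𝟘)(σ) = ⨅_{n∈ℕ} ⨁_{π ∈ Paths_n(C,σ)} weight(π) ⊗ ⊤, where Paths_n(C,σ) is the set of computation paths of length exactly n of the operational semantics starting in configuration (C,σ), weight(π) is the ordered product in M of the transition weights along π, ⊤ is the greatest element of S, and the inner sum is the (countable) module sum. -/

import Mathlib

/-! ## Monoid modules, natural order, ω-(co)continuity -/

structure MonModule (M : Type) [Monoid M] (S : Type) where
  add : S → S → S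
  zero : S
  smul : M → S → S
  add_assoc : ∀ a b c : S, add (add a b) c = add a (add b c)
  add_comm : ∀ a b : S, add a b = add b a
  add_zero : ∀ a : S, add a zero = a
  smul_assoc : ∀ (u v : M) (a : S), smul (u * v) a = smul u (smul v a)
  smul_add : ∀ (u : M) (a b : S), smul u (add a b) = add (smul u a) (smul u b)
  one_smul : ∀ a : S, smul 1 a = a
  smul_zero : ∀ u : M, smul u zero = zero

namespace MonModule

variable {M S : Type} [Monoid M]

/-- The natural (pre)order: `a ⪯ b` iff `∃ c, a ⊕ c = b`. -/
def le (mm : MonModule M S) (a b : S) : Prop := ∃ c : S, mm.add a c = b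

/-- `S` is naturally ordered if the natural order is antisymmetric (hence a partial order). -/
def NaturallyOrdered (mm : MonModule M S) : Prop :=
  ∀ a b : S, mm.le a b → mm.le b a → a = b

/-- ω-chain (ascending). -/
def Chain (mm : MonModule M S) (s : ℕ → S) : Prop := ∀ n : ℕ, mm.le (s n) (s (n + 1))

/-- ω-descending chain. -/
def DChain (mm : MonModule M S) (s : ℕ → S) : Prop := ∀ n : ℕ, mm.le (s (n + 1)) (s n)

/-- `x` is the supremum (least upper bound) of `s` w.r.t. the natural order. -/
def IsSup (mm : MonModule M S) (s : ℕ → S) (x : S) : Prop :=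
  (∀ n : ℕ, mm.le (s n) x) ∧ ∀ y : S, (∀ n : ℕ, mm.le (s n) y) → mm.le x y

/-- `x` is the infimum (greatest lower bound) of `s` w.r.t. the natural order. -/
def IsInf (mm : MonModule M S) (s : ℕ → S) (x : S) : Prop :=
  (∀ n : ℕ, mm.le x (s n)) ∧ ∀ y : S, (∀ n : ℕ, mm.le y (s n)) → mm.le y x

end MonModule

/-- `S` is ω-continuous: suprema of ω-chains exist (with least element `𝟘`, which is
automatically least for the natural order), and `⊕`, `⊗` are ω-continuous. -/
structure OmegaContinuous {M S : Type} [Monoid M] (mm : MonModule M S) : Prop where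
  sup_exists : ∀ s : ℕ → S, mm.Chain s → ∃ x : S, mm.IsSup s x
  add_cont : ∀ (a : S) (s : ℕ → S) (x : S), mm.Chain s → mm.IsSup s x →
    mm.IsSup (fun n => mm.add a (s n)) (mm.add a x)
  smul_cont : ∀ (u : M) (s : ℕ → S) (x : S), mm.Chain s → mm.IsSup s x →
    mm.IsSup (fun n => mm.smul u (s n)) (mm.smul u x)

/-- `S` is ω-cocontinuous: a greatest element exists, infima of ω-descending chains exist,
and `⊕`, `⊗` are ω-cocontinuous. -/
structure OmegaCocontinuous {M S : Type} [Monoid M] (mm : MonModule M S) : Prop where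
  top_exists : ∃ t : S, ∀ a : S, mm.le a t
  inf_exists : ∀ s : ℕ → S, mm.DChain s → ∃ x : S, mm.IsInf s x
  add_cocont : ∀ (a : S) (s : ℕ → S) (x : S), mm.DChain s → mm.IsInf s x →
    mm.IsInf (fun n => mm.add a (s n)) (mm.add a x)
  smul_cocont : ∀ (u : M) (s : ℕ → S) (x : S), mm.DChain s → mm.IsInf s x →
    mm.IsInf (fun n => mm.smul u (s n)) (mm.smul u x)

def OmegaBicontinuous {M S : Type} [Monoid M] (mm : MonModule M S) : Prop :=
  OmegaContinuous mm ∧ OmegaCocontinuous mm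

/-! ## Weightings (pointwise lifting to `St → S`) -/

section Weightings

variable {M S St : Type} [Monoid M]

/-- Pointwise natural order on weightings. -/
def wle (mm : MonModule M S) (f g : St → S) : Prop := ∀ σ : St, mm.le (f σ) (g σ)

def WChain (mm : MonModule M S) (s : ℕ → St → S) : Prop := ∀ n : ℕ, wle mm (s n) (s (n + 1))

def WDChain (mm : MonModule M S) (s : ℕ → St → S) : Prop := ∀ n : ℕ, wle mm (s (n + 1)) (s n)

def WIsSup (mm : MonModule M S) (s : ℕ → St → S) (x : St → S) : Prop :=
  (∀ n : ℕ, wle mm (s n) x) ∧ ∀ y : St → S, (∀ n : ℕ, wle mm (s n) y) → wle mm x y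

def WIsInf (mm : MonModule M S) (s : ℕ → St → S) (x : St → S) : Prop :=
  (∀ n : ℕ, wle mm x (s n)) ∧ ∀ y : St → S, (∀ n : ℕ, wle mm y (s n)) → wle mm y x

end Weightings

/-! ## wGCL syntax -/

/-- wGCL programs over weights from `M` and program states from `St`:
assignments (as state transformations), sequencing, conditionals, nondeterministic
branching, weighting `⊙ a`, and loops. -/
inductive WGCL (M : Type) (St : Type) : Type
  | assign : (St → St) → WGCL M St
  | seq : WGCL M St → WGCL M St → WGCL M St
  | ite : Set St → WGCL M St → WGCL M St → WGCL M St
  | branch : WGCL M St → WGCL M St → WGCL M St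
  | weight : M → WGCL M St
  | wloop : Set St → WGCL M St → WGCL M St

section Transformers

variable {M S St : Type} [Monoid M]

/-- Iverson-bracket guarding `[φ] ⋄ f`. -/
noncomputable def iv (mm : MonModule M S) (φ : Set St) (f : St → S) : St → S :=
  fun σ => @ite _ (σ ∈ φ) (Classical.propDecidable _) (f σ) mm.zero

/-- Least fixed point of `Φ` w.r.t. the pointwise natural order (chosen by classical choice
if it exists; arbitrary otherwise). -/
noncomputable def wlfp (mm : MonModule M S) (Φ : (St → S) → St → S) : St → S :=
  @dite _ (∃ x : St → S, Φ x = x ∧ ∀ y : St → S, Φ y = y → wle mm x y)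
    (Classical.propDecidable _) (fun h => h.choose) (fun _ => fun _ => mm.zero)

/-- Greatest fixed point of `Φ` w.r.t. the pointwise natural order. -/
noncomputable def wgfp (mm : MonModule M S) (Φ : (St → S) → St → S) : St → S :=
  @dite _ (∃ x : St → S, Φ x = x ∧ ∀ y : St → S, Φ y = y → wle mm y x)
    (Classical.propDecidable _) (fun h => h.choose) (fun _ => fun _ => mm.zero)

/-- Weakest preweighting transformer `wp`. -/
noncomputable def wp (mm : MonModule M S) : WGCL M St → (St → S) → St → S
  | WGCL.assign g => fun f σ => f (g σ)
  | WGCL.seq C₁ C₂ => fun f => wp mm C₁ (wp mm C₂ f)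
  | WGCL.ite φ C₁ C₂ => fun f σ => mm.add (iv mm φ (wp mm C₁ f) σ) (iv mm φᶜ (wp mm C₂ f) σ)
  | WGCL.branch C₁ C₂ => fun f σ => mm.add (wp mm C₁ f σ) (wp mm C₂ f σ)
  | WGCL.weight a => fun f σ => mm.smul a (f σ)
  | WGCL.wloop φ C' => fun f =>
      wlfp mm (fun X σ => mm.add (iv mm φᶜ f σ) (iv mm φ (wp mm C' X) σ))

/-- The `wp`-characteristic function `Φ_f(X) = [¬φ]⋄f ⊕ [φ]⋄wp[C'](X)` of `while(φ){C'}`. -/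
noncomputable def charW (mm : MonModule M S) (φ : Set St) (C' : WGCL M St) (f : St → S)
    (X : St → S) : St → S :=
  fun σ => mm.add (iv mm φᶜ f σ) (iv mm φ (wp mm C' X) σ)

/-- Weakest liberal preweighting transformer `wlp`. -/
noncomputable def wlp (mm : MonModule M S) : WGCL M St → (St → S) → St → S
  | WGCL.assign g => fun f σ => f (g σ)
  | WGCL.seq C₁ C₂ => fun f => wlp mm C₁ (wlp mm C₂ f)
  | WGCL.ite φ C₁ C₂ => fun f σ => mm.add (iv mm φ (wlp mm C₁ f) σ) (iv mm φᶜ (wlp mm C₂ f) σ)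
  | WGCL.branch C₁ C₂ => fun f σ => mm.add (wlp mm C₁ f σ) (wlp mm C₂ f σ)
  | WGCL.weight a => fun f σ => mm.smul a (f σ)
  | WGCL.wloop φ C' => fun f =>
      wgfp mm (fun X σ => mm.add (iv mm φᶜ f σ) (iv mm φ (wlp mm C' X) σ))

/-- The `wlp`-characteristic function `Ψ_f(X) = [¬φ]⋄f ⊕ [φ]⋄wlp[C'](X)` of `while(φ){C'}`. -/
noncomputable def charWlp (mm : MonModule M S) (φ : Set St) (C' : WGCL M St) (f : St → S)
    (X : St → S) : St → S :=
  fun σ => mm.add (iv mm φᶜ f σ) (iv mm φ (wlp mm C' X) σ)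

end Transformers

/-! ## Operational semantics -/

/-- Configurations: `none` is a terminal configuration. -/
abbrev Conf (M St : Type) := Option (WGCL M St) × St

section Operational

variable {M St : Type} [Monoid M]

/-- Weighted small-step operational semantics: each transition carries a weight in `M`
(the weight `a` for executing `⊙ a`, and `1` otherwise). -/
inductive Step : Conf M St → M → Conf M St → Prop
  | assign (g : St → St) (σ : St) : Step (some (WGCL.assign g), σ) 1 (none, g σ)
  | weight (a : M) (σ : St) : Step (some (WGCL.weight a), σ) a (none, σ)
  | seq_fin {C₁ : WGCL M St} {σ : St} {w : M} {σ' : St} (C₂ : WGCL M St) :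
      Step (some C₁, σ) w (none, σ') → Step (some (WGCL.seq C₁ C₂), σ) w (some C₂, σ')
  | seq_step {C₁ : WGCL M St} {σ : St} {w : M} {C₁' : WGCL M St} {σ' : St} (C₂ : WGCL M St) :
      Step (some C₁, σ) w (some C₁', σ') →
      Step (some (WGCL.seq C₁ C₂), σ) w (some (WGCL.seq C₁' C₂), σ')
  | ite_left {φ : Set St} {σ : St} (C₁ C₂ : WGCL M St) :
      σ ∈ φ → Step (some (WGCL.ite φ C₁ C₂), σ) 1 (some C₁, σ)
  | ite_right {φ : Set St} {σ : St} (C₁ C₂ : WGCL M St) :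
      σ ∉ φ → Step (some (WGCL.ite φ C₁ C₂), σ) 1 (some C₂, σ)
  | branch_left (C₁ C₂ : WGCL M St) (σ : St) :
      Step (some (WGCL.branch C₁ C₂), σ) 1 (some C₁, σ)
  | branch_right (C₁ C₂ : WGCL M St) (σ : St) :
      Step (some (WGCL.branch C₁ C₂), σ) 1 (some C₂, σ)
  | loop_enter {φ : Set St} {σ : St} (C : WGCL M St) :
      σ ∈ φ → Step (some (WGCL.wloop φ C), σ) 1 (some (WGCL.seq C (WGCL.wloop φ C)), σ)
  | loop_exit {φ : Set St} {σ : St} (C : WGCL M St) :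
      σ ∉ φ → Step (some (WGCL.wloop φ C), σ) 1 (none, σ)

/-- A finite computation path from configuration `c`, recorded as the list of
(transition weight, successor configuration) pairs. -/
inductive Steps : Conf M St → List (M × Conf M St) → Prop
  | nil (c : Conf M St) : Steps c []
  | cons {c : Conf M St} {w : M} {c' : Conf M St} {l : List (M × Conf M St)} :
      Step c w c' → Steps c' l → Steps c ((w, c') :: l)

/-- Weight of a computation path: the ordered product of its transition weights. -/
def pathWeight (l : List (M × Conf M St)) : M := (l.map Prod.fst).prod

/-- Final state of a (nonempty) computation path; `σ` for the empty path. -/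
def lastState (σ : St) (l : List (M × Conf M St)) : St :=
  (l.getLastD ((1 : M), ((none : Option (WGCL M St)), σ))).2.2

/-- A terminating computation path from `c`: a finite path ending in a terminal
configuration. -/
def TermPath (c : Conf M St) (l : List (M × Conf M St)) : Prop :=
  Steps c l ∧ ∃ p : M × Conf M St, l.getLast? = some p ∧ p.2.1 = (none : Option (WGCL M St))

/-- There is an infinite computation path starting in `c`. -/
def InfinitePathFrom (c : Conf M St) : Prop :=
  ∃ π : ℕ → Conf M St, π 0 = c ∧ ∀ n : ℕ, ∃ w : M, Step (π n) w (π (n + 1))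

end Operational

/-! ## Countable module sums as suprema of finite partial sums -/

section Sums

variable {M S : Type} [Monoid M]

/-- Finite sum of `g` over the elements of a list. -/
def finListSum (mm : MonModule M S) {ι : Type} (g : ι → S) : List ι → S
  | [] => mm.zero
  | i :: t => mm.add (g i) (finListSum mm g t)

/-- `x` is the (countable) module sum `⨁_{i ∈ T} g i`, i.e. the least upper bound
of all finite partial sums over duplicate-free lists of elements of `T`. -/
def IsSumOver (mm : MonModule M S) {ι : Type} (T : Set ι) (g : ι → S) (x : S) : Prop :=
  (∀ l : List ι, l.Nodup → (∀ i ∈ l, i ∈ T) → mm.le (finListSum mm g l) x) ∧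
  ∀ y : S, (∀ l : List ι, l.Nodup → (∀ i ∈ l, i ∈ T) → mm.le (finListSum mm g l) y) → mm.le x y

end Sums

namespace MonModule

variable {M S : Type} [Monoid M] {mm : MonModule M S}

theorem le_refl (a : S) : mm.le a a := ⟨mm.zero, mm.add_zero a⟩

theorem le_trans {a b c : S} (hab : mm.le a b) (hbc : mm.le b c) : mm.le a c := by
  obtain ⟨d, rfl⟩ := hab
  obtain ⟨e, rfl⟩ := hbc
  exact ⟨mm.add d e, (mm.add_assoc a d e).symm⟩

theorem zero_add (a : S) : mm.add mm.zero a = a := by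
  rw [mm.add_comm, mm.add_zero]

theorem zero_le (a : S) : mm.le mm.zero a := ⟨a, zero_add a⟩

theorem add_add_add_comm (a b c d : S) :
    mm.add (mm.add a b) (mm.add c d) = mm.add (mm.add a c) (mm.add b d) := by
  rw [mm.add_assoc, mm.add_assoc, ← mm.add_assoc b c d, mm.add_comm b c, mm.add_assoc c b d]

theorem add_le_add {a b c d : S} (hab : mm.le a b) (hcd : mm.le c d) :
    mm.le (mm.add a c) (mm.add b d) := by
  obtain ⟨x, rfl⟩ := hab
  obtain ⟨y, rfl⟩ := hcd
  exact ⟨mm.add x y, add_add_add_comm a c x y⟩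

theorem smul_le_smul (u : M) {a b : S} (hab : mm.le a b) :
    mm.le (mm.smul u a) (mm.smul u b) := by
  obtain ⟨x, rfl⟩ := hab
  exact ⟨mm.smul u x, (mm.smul_add u a x).symm⟩

theorem DChain.antitone {s : ℕ → S} (hs : mm.DChain s) {m n : ℕ} (hmn : m ≤ n) :
    mm.le (s n) (s m) := by
  induction hmn with
  | refl => exact le_refl _
  | step _ ih => exact le_trans (hs _) ih

theorem DChain.add {s t : ℕ → S} (hs : mm.DChain s) (ht : mm.DChain t) :
    mm.DChain (fun n => mm.add (s n) (t n)) := fun n => add_le_add (hs n) (ht n)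

theorem DChain.smul (u : M) {s : ℕ → S} (hs : mm.DChain s) :
    mm.DChain (fun n => mm.smul u (s n)) := fun n => smul_le_smul u (hs n)

theorem isInf_const (a : S) : mm.IsInf (fun _ => a) a :=
  ⟨fun _ => le_refl a, fun _ h => h 0⟩

theorem IsInf.of_succ {s : ℕ → S} {x : S} (hs : mm.DChain s)
    (h : mm.IsInf (fun n => s (n + 1)) x) : mm.IsInf s x :=
  ⟨fun n => le_trans (h.1 n) (hs n), fun y hy => h.2 y fun n => hy (n + 1)⟩

theorem IsInf.succ {s : ℕ → S} {x : S} (hs : mm.DChain s)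
    (h : mm.IsInf s x) : mm.IsInf (fun n => s (n + 1)) x :=
  ⟨fun n => h.1 (n + 1), fun y hy => h.2 y fun n => le_trans (hy n) (hs n)⟩

theorem IsInf.unique (hord : mm.NaturallyOrdered) {s : ℕ → S} {x y : S} (hx : mm.IsInf s x)
    (hy : mm.IsInf s y) : x = y :=
  hord _ _ (hy.2 x hx.1) (hx.2 y hy.1)

theorem IsInf.add (hco : OmegaCocontinuous mm) {s t : ℕ → S} {x y : S} (hs : mm.DChain s)
    (ht : mm.DChain t) (hx : mm.IsInf s x) (hy : mm.IsInf t y) :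
    mm.IsInf (fun n => mm.add (s n) (t n)) (mm.add x y) := by
  refine ⟨fun n => add_le_add (hx.1 n) (hy.1 n), fun z hz => ?_⟩
  have hzs : ∀ n, mm.le z (mm.add y (s n)) := fun n => by
    rw [mm.add_comm]
    exact (hco.add_cocont (s n) t y ht hy).2 z fun m =>
      le_trans (hz (max n m))
        (add_le_add (hs.antitone (le_max_left n m)) (ht.antitone (le_max_right n m)))
  rw [mm.add_comm]
  exact (hco.add_cocont y s x hs hx).2 z hzs

end MonModule

section ListSums

open MonModule

variable {M S : Type} [Monoid M] {mm : MonModule M S} {ι κ : Type}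

theorem finListSum_map (e : ι → κ) (g : κ → S) (l : List ι) :
    finListSum mm g (l.map e) = finListSum mm (fun i => g (e i)) l := by
  induction l with
  | nil => rfl
  | cons i t ih => simp only [List.map_cons, finListSum, ih]

theorem finListSum_append (g : ι → S) (l l' : List ι) :
    finListSum mm g (l ++ l') = mm.add (finListSum mm g l) (finListSum mm g l') := by
  induction l with
  | nil => exact (MonModule.zero_add _).symm
  | cons i t ih => simp only [List.cons_append, finListSum, ih, mm.add_assoc]

theorem finListSum_flatMap (e : ι → List κ) (g : κ → S) (l : List ι) :
    finListSum mm g (l.flatMap e) = finListSum mm (fun i => finListSum mm g (e i)) l := by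
  induction l with
  | nil => rfl
  | cons i t ih => simp only [List.flatMap_cons, finListSum_append, finListSum, ih]

theorem finListSum_smul (u : M) (g : ι → S) (l : List ι) :
    finListSum mm (fun i => mm.smul u (g i)) l = mm.smul u (finListSum mm g l) := by
  induction l with
  | nil => exact (mm.smul_zero u).symm
  | cons i t ih => simp only [finListSum, ih, mm.smul_add]

theorem finListSum_singleton (g : ι → S) (i : ι) : finListSum mm g [i] = g i :=
  mm.add_zero _

theorem finListSum_pair (g : ι → S) (i j : ι) : finListSum mm g [i, j] = mm.add (g i) (g j) := by
  simp only [finListSum, mm.add_zero]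

theorem finListSum_mono {g g' : ι → S} (h : ∀ i, mm.le (g i) (g' i)) (l : List ι) :
    mm.le (finListSum mm g l) (finListSum mm g' l) := by
  induction l with
  | nil => exact le_refl _
  | cons i t ih => exact add_le_add (h i) ih

theorem le_finListSum (g : ι → S) {l : List ι} {i : ι} (hi : i ∈ l) :
    mm.le (g i) (finListSum mm g l) := by
  induction l with
  | nil => cases hi
  | cons j t ih =>
    rcases List.mem_cons.1 hi with rfl | hi
    · exact ⟨_, rfl⟩
    · exact le_trans (ih hi) ⟨g j, mm.add_comm _ _⟩

theorem finListSum_le {g : ι → S} {l : List ι} {x : S} (hx : mm.add x x = x)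
    (h : ∀ i ∈ l, mm.le (g i) x) : mm.le (finListSum mm g l) x := by
  induction l with
  | nil => exact zero_le x
  | cons i t ih =>
    have := add_le_add (h i List.mem_cons_self) (ih fun j hj => h j (List.mem_cons_of_mem i hj))
    rwa [hx] at this

theorem finListSum_add_self {g : ι → S} (hg : ∀ i, mm.add (g i) (g i) = g i) (l : List ι) :
    mm.add (finListSum mm g l) (finListSum mm g l) = finListSum mm g l := by
  induction l with
  | nil => exact mm.add_zero _
  | cons i t ih => simp only [finListSum]; rw [MonModule.add_add_add_comm, hg, ih]

open Classical in
/-- A sum of idempotents over a finite set does not depend on repetitions in its enumeration. -/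
theorem isSumOver_finListSum {g : ι → S} (hg : ∀ i, mm.add (g i) (g i) = g i) {T : Set ι}
    {L : List ι} (hL : ∀ i, i ∈ L ↔ i ∈ T) : IsSumOver mm T g (finListSum mm g L) := by
  refine ⟨fun l _ hl => finListSum_le (finListSum_add_self hg L) fun i hi =>
    le_finListSum g ((hL i).2 (hl i hi)), fun y hy => ?_⟩
  refine le_trans (finListSum_le (finListSum_add_self hg L.dedup) fun i hi =>
    le_finListSum g (List.mem_dedup.2 hi)) (hy L.dedup (List.nodup_dedup L) fun i hi => ?_)
  exact (hL i).1 (List.mem_dedup.1 hi)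

theorem isInf_finListSum (hco : OmegaCocontinuous mm) {g : ℕ → ι → S} {x : ι → S}
    (hg : ∀ i, mm.DChain fun n => g n i) (hx : ∀ i, mm.IsInf (fun n => g n i) (x i))
    (l : List ι) : mm.IsInf (fun n => finListSum mm (g n) l) (finListSum mm x l) := by
  induction l with
  | nil => exact isInf_const _
  | cons i t ih =>
    exact IsInf.add hco (hg i) (fun n => finListSum_mono (fun j => hg j n) t) (hx i) ih

end ListSums

section Successors

variable {M St : Type} [Monoid M]

/-- The configuration reached by `C₁; C₂` when `C₁` steps to the given configuration. -/
def Conf.seq (C₂ : WGCL M St) : Conf M St → Conf M St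
  | (none, σ) => (some C₂, σ)
  | (some C₁, σ) => (some (WGCL.seq C₁ C₂), σ)

open Classical in
/-- The weighted successors of a program in a state; both branches of a nondeterministic choice
are listed even if they coincide. -/
noncomputable def WGCL.succs : WGCL M St → St → List (M × Conf M St)
  | .assign g, σ => [(1, none, g σ)]
  | .seq C₁ C₂, σ => (C₁.succs σ).map fun p => (p.1, Conf.seq C₂ p.2)
  | .ite φ C₁ C₂, σ => if σ ∈ φ then [(1, some C₁, σ)] else [(1, some C₂, σ)]
  | .branch C₁ C₂, σ => [(1, some C₁, σ), (1, some C₂, σ)]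
  | .weight a, σ => [(a, none, σ)]
  | .wloop φ C, σ => if σ ∈ φ then [(1, some (.seq C (.wloop φ C)), σ)] else [(1, none, σ)]

/-- The weighted successors of a configuration. -/
noncomputable def Conf.succs : Conf M St → List (M × Conf M St)
  | (none, _) => []
  | (some C, σ) => C.succs σ

theorem WGCL.mem_succs_of_step {c : Conf M St} {w : M} {c' : Conf M St} (h : Step c w c') :
    (w, c') ∈ Conf.succs c := by
  induction h with
  | assign | weight | branch_left | branch_right => simp [Conf.succs, WGCL.succs]
  | seq_fin _ _ ih => exact List.mem_map.2 ⟨_, ih, rfl⟩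
  | seq_step _ _ ih => exact List.mem_map.2 ⟨_, ih, rfl⟩
  | ite_left _ _ h | ite_right _ _ h => simp [Conf.succs, WGCL.succs, h]
  | loop_enter _ h | loop_exit _ h => simp [Conf.succs, WGCL.succs, h]

theorem WGCL.step_of_mem_succs {C : WGCL M St} {σ : St} {p : M × Conf M St}
    (h : p ∈ C.succs σ) : Step (some C, σ) p.1 p.2 := by
  induction C generalizing σ p with
  | assign g =>
    obtain rfl := List.mem_singleton.1 h
    exact Step.assign g σ
  | weight a =>
    obtain rfl := List.mem_singleton.1 h
    exact Step.weight a σ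
  | seq C₁ C₂ ih₁ _ =>
    obtain ⟨⟨w, _ | C, σ'⟩, hq, rfl⟩ := List.mem_map.1 h
    · exact Step.seq_fin C₂ (ih₁ hq)
    · exact Step.seq_step C₂ (ih₁ hq)
  | ite φ C₁ C₂ =>
    by_cases hσ : σ ∈ φ
    · simp only [WGCL.succs, if_pos hσ, List.mem_singleton] at h
      subst h
      exact Step.ite_left C₁ C₂ hσ
    · simp only [WGCL.succs, if_neg hσ, List.mem_singleton] at h
      subst h
      exact Step.ite_right C₁ C₂ hσ
  | branch C₁ C₂ =>
    simp only [WGCL.succs, List.mem_cons, List.not_mem_nil, or_false] at h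
    rcases h with rfl | rfl
    · exact Step.branch_left C₁ C₂ σ
    · exact Step.branch_right C₁ C₂ σ
  | wloop φ C =>
    by_cases hσ : σ ∈ φ
    · simp only [WGCL.succs, if_pos hσ, List.mem_singleton] at h
      subst h
      exact Step.loop_enter C hσ
    · simp only [WGCL.succs, if_neg hσ, List.mem_singleton] at h
      subst h
      exact Step.loop_exit C hσ

theorem Conf.mem_succs {c : Conf M St} {p : M × Conf M St} :
    p ∈ Conf.succs c ↔ Step c p.1 p.2 := by
  refine ⟨fun h => ?_, WGCL.mem_succs_of_step⟩
  obtain ⟨_ | C, σ⟩ := c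
  · cases h
  · exact WGCL.step_of_mem_succs h

/-- The computation paths of length `n` from a configuration, possibly with repetitions. -/
noncomputable def Conf.paths : ℕ → Conf M St → List (List (M × Conf M St))
  | 0, _ => [[]]
  | n + 1, c => (Conf.succs c).flatMap fun p => (Conf.paths n p.2).map (p :: ·)

theorem Conf.mem_paths {n : ℕ} {c : Conf M St} {l : List (M × Conf M St)} :
    l ∈ Conf.paths n c ↔ Steps c l ∧ l.length = n := by
  induction n generalizing c l with
  | zero =>
    simp only [Conf.paths, List.mem_singleton, List.length_eq_zero_iff]
    exact ⟨fun h => ⟨h ▸ Steps.nil c, h⟩, fun h => h.2⟩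
  | succ n ih =>
    simp only [Conf.paths, List.mem_flatMap, List.mem_map, Conf.mem_succs, ih]
    constructor
    · rintro ⟨p, hp, l, ⟨hl, rfl⟩, rfl⟩
      exact ⟨Steps.cons hp hl, rfl⟩
    · rintro ⟨h, hn⟩
      cases h with
      | nil => cases hn
      | cons hs hl => exact ⟨_, hs, _, ⟨hl, Nat.succ.inj hn⟩, rfl⟩

end Successors

section Approximations

open MonModule

variable {M S St : Type} [Monoid M] {mm : MonModule M S}

theorem smul_top_add_self (hord : mm.NaturallyOrdered) {top : S} (htop : ∀ a, mm.le a top)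
    (u : M) : mm.add (mm.smul u top) (mm.smul u top) = mm.smul u top := by
  rw [← mm.smul_add, hord (mm.add top top) top (htop _) ⟨top, rfl⟩]

theorem finListSum_paths_succ (top : S) (n : ℕ) (c : Conf M St) :
    finListSum mm (fun l => mm.smul (pathWeight l) top) (Conf.paths (n + 1) c) =
      finListSum mm (fun p => mm.smul p.1
        (finListSum mm (fun l => mm.smul (pathWeight l) top) (Conf.paths n p.2)))
        (Conf.succs c) := by
  rw [Conf.paths, finListSum_flatMap]
  congr 1
  funext p
  rw [finListSum_map, ← finListSum_smul]
  congr 1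
  funext l
  rw [← mm.smul_assoc, pathWeight, List.map_cons, List.prod_cons, ← pathWeight]

/-- The weighting of a configuration obtained by running it for `n` steps, with terminal states
weighted by `f` and runs still unfinished weighted by `top`. -/
noncomputable def wlpApprox (mm : MonModule M S) (top : S) (f : St → S) : ℕ → Conf M St → S
  | _, (none, σ) => f σ
  | 0, (some _, _) => top
  | n + 1, (some C, σ) =>
      finListSum mm (fun p => mm.smul p.1 (wlpApprox mm top f n p.2)) (C.succs σ)

variable {top : S}

theorem wlpApprox_none (f : St → S) (n : ℕ) (σ : St) :
    wlpApprox (M := M) mm top f n (none, σ) = f σ := by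
  cases n <;> simp only [wlpApprox]

theorem wlpApprox_succ (f : St → S) (n : ℕ) (C : WGCL M St) (σ : St) :
    wlpApprox mm top f (n + 1) (some C, σ) =
      finListSum mm (fun p => mm.smul p.1 (wlpApprox mm top f n p.2)) (C.succs σ) := by
  simp only [wlpApprox]

theorem wlpApprox_succ_seq (f : St → S) (n : ℕ) (C₁ C₂ : WGCL M St) (σ : St) :
    wlpApprox mm top f (n + 1) (some (.seq C₁ C₂), σ) =
      finListSum mm (fun p => mm.smul p.1 (wlpApprox mm top f n (Conf.seq C₂ p.2)))
        (C₁.succs σ) := by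
  rw [wlpApprox_succ, WGCL.succs, finListSum_map]

theorem wlpApprox_dchain (htop : ∀ a, mm.le a top) (f : St → S) (c : Conf M St) :
    mm.DChain fun n => wlpApprox mm top f n c := by
  intro n
  induction n generalizing c with
  | zero =>
    obtain ⟨_ | C, σ⟩ := c
    · simp only [wlpApprox_none]; exact le_refl _
    · exact htop _
  | succ n ih =>
    obtain ⟨_ | C, σ⟩ := c
    · simp only [wlpApprox_none]; exact le_refl _
    · simp only [wlpApprox_succ _ _ C]
      exact finListSum_mono (fun p : M × Conf M St => smul_le_smul _ (ih p.2)) _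

theorem wlpApprox_mono {f g : St → S} (hfg : wle mm f g) (n : ℕ) (c : Conf M St) :
    mm.le (wlpApprox mm top f n c) (wlpApprox mm top g n c) := by
  induction n generalizing c with
  | zero =>
    obtain ⟨_ | C, σ⟩ := c
    · exact hfg σ
    · exact le_refl _
  | succ n ih =>
    obtain ⟨_ | C, σ⟩ := c
    · exact hfg σ
    · simp only [wlpApprox_succ]
      exact finListSum_mono (fun p : M × Conf M St => smul_le_smul _ (ih p.2)) _

theorem isInf_wlpApprox_of_isInf (hco : OmegaCocontinuous mm) {g : ℕ → St → S} {h : St → S}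
    (hg : ∀ σ, mm.DChain fun m => g m σ) (hh : ∀ σ, mm.IsInf (fun m => g m σ) (h σ))
    (n : ℕ) (c : Conf M St) :
    mm.IsInf (fun m => wlpApprox mm top (g m) n c) (wlpApprox mm top h n c) := by
  induction n generalizing c with
  | zero =>
    obtain ⟨_ | C, σ⟩ := c
    · exact hh σ
    · exact isInf_const _
  | succ n ih =>
    obtain ⟨_ | C, σ⟩ := c
    · exact hh σ
    · have hch : ∀ c : Conf M St, mm.DChain fun m => wlpApprox mm top (g m) n c :=
        fun c m => wlpApprox_mono (fun σ => hg σ m) n c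
      simp only [wlpApprox_succ]
      exact isInf_finListSum hco (fun p : M × Conf M St => (hch p.2).smul p.1)
        (fun p : M × Conf M St => hco.smul_cocont p.1 _ _ (hch p.2) (ih p.2)) _

theorem wlpApprox_le_seq (htop : ∀ a, mm.le a top) (f : St → S) (C₁ C₂ : WGCL M St) (σ : St)
    {n m : ℕ} (hnm : n ≤ m) :
    mm.le (wlpApprox mm top (fun τ => wlpApprox mm top f m (some C₂, τ)) n (some C₁, σ))
      (wlpApprox mm top f n (some (.seq C₁ C₂), σ)) := by
  induction n generalizing C₁ σ with
  | zero => exact htop _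
  | succ n ih =>
    rw [wlpApprox_succ_seq, wlpApprox_succ]
    refine finListSum_mono (fun p => smul_le_smul _ ?_) _
    obtain ⟨w, _ | C, τ⟩ := p
    · rw [wlpApprox_none]
      exact (wlpApprox_dchain htop f (some C₂, τ)).antitone (by omega)
    · exact ih C τ (by omega)

theorem wlpApprox_seq_le (htop : ∀ a, mm.le a top) (f : St → S) (C₁ C₂ : WGCL M St) (σ : St)
    (n m : ℕ) :
    mm.le (wlpApprox mm top f (n + m) (some (.seq C₁ C₂), σ))
      (wlpApprox mm top (fun τ => wlpApprox mm top f m (some C₂, τ)) n (some C₁, σ)) := by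
  induction n generalizing C₁ σ with
  | zero => exact htop _
  | succ n ih =>
    rw [Nat.succ_add, wlpApprox_succ_seq, wlpApprox_succ]
    refine finListSum_mono (fun p => smul_le_smul _ ?_) _
    obtain ⟨w, _ | C, τ⟩ := p
    · rw [wlpApprox_none]
      exact (wlpApprox_dchain htop f (some C₂, τ)).antitone (by omega)
    · exact ih C τ

theorem isInf_wlpApprox_seq (hco : OmegaCocontinuous mm) (htop : ∀ a, mm.le a top)
    {f h : St → S} {C₁ C₂ : WGCL M St} {σ : St} {x : S}
    (h₂ : ∀ τ, mm.IsInf (fun n => wlpApprox mm top f n (some C₂, τ)) (h τ))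
    (h₁ : mm.IsInf (fun n => wlpApprox mm top h n (some C₁, σ)) x) :
    mm.IsInf (fun n => wlpApprox mm top f n (some (.seq C₁ C₂), σ)) x := by
  refine ⟨fun n => ?_, fun y hy => h₁.2 y fun n => ?_⟩
  · exact le_trans (h₁.1 n) (le_trans (wlpApprox_mono (fun τ => (h₂ τ).1 n) n _)
      (wlpApprox_le_seq htop f C₁ C₂ σ n.le_refl))
  · exact (isInf_wlpApprox_of_isInf hco (fun τ => wlpApprox_dchain htop f (some C₂, τ)) h₂ n
      (some C₁, σ)).2 y fun m => le_trans (hy (n + m)) (wlpApprox_seq_le htop f C₁ C₂ σ n m)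

theorem wgfp_eq (hord : mm.NaturallyOrdered) {Φ : (St → S) → St → S} {x : St → S}
    (hx : Φ x = x) (hmax : ∀ y, Φ y = y → wle mm y x) : wgfp mm Φ = x := by
  have hex : ∃ x : St → S, Φ x = x ∧ ∀ y : St → S, Φ y = y → wle mm y x := ⟨x, hx, hmax⟩
  have hspec := hex.choose_spec
  rw [wgfp, dif_pos hex]
  funext σ
  exact hord _ _ (hmax _ hspec.1 σ) (hspec.2 x hx σ)

theorem iv_of_mem {φ : Set St} {σ : St} (h : σ ∈ φ) (f : St → S) : iv mm φ f σ = f σ :=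
  if_pos h

theorem iv_of_notMem {φ : Set St} {σ : St} (h : σ ∉ φ) (f : St → S) :
    iv mm φ f σ = mm.zero :=
  if_neg h

theorem wlpApprox_succ_wloop_of_mem (f : St → S) (n : ℕ) {φ : Set St} {σ : St} (hσ : σ ∈ φ)
    (C : WGCL M St) : wlpApprox mm top f (n + 1) (some (.wloop φ C), σ) =
      wlpApprox mm top f n (some (.seq C (.wloop φ C)), σ) := by
  rw [wlpApprox_succ, WGCL.succs, if_pos hσ, finListSum_singleton, mm.one_smul]

theorem wlpApprox_succ_wloop_of_notMem (f : St → S) (n : ℕ) {φ : Set St} {σ : St} (hσ : σ ∉ φ)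
    (C : WGCL M St) : wlpApprox mm top f (n + 1) (some (.wloop φ C), σ) = f σ := by
  rw [wlpApprox_succ, WGCL.succs, if_neg hσ, finListSum_singleton, mm.one_smul, wlpApprox_none]

theorem isInf_wlpApprox_wloop (hord : mm.NaturallyOrdered) (hco : OmegaCocontinuous mm)
    (htop : ∀ a, mm.le a top) (φ : Set St) {C : WGCL M St}
    (hC : ∀ f σ, mm.IsInf (fun n => wlpApprox mm top f n (some C, σ)) (wlp mm C f σ))
    (f : St → S) (σ : St) :
    mm.IsInf (fun n => wlpApprox mm top f n (some (.wloop φ C), σ))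
      (wlp mm (.wloop φ C) f σ) := by
  choose L hL using fun τ => hco.inf_exists _ (wlpApprox_dchain htop f (some (.wloop φ C), τ))
  suffices h : wlp mm (.wloop φ C) f = L by rw [h]; exact hL σ
  refine wgfp_eq hord (funext fun τ => ?_) fun Y hY τ => (hL τ).2 _ fun n => ?_
  · refine IsInf.unique hord ?_ ((hL τ).succ (wlpApprox_dchain htop f _))
    by_cases hτ : τ ∈ φ
    · rw [iv_of_notMem (φ := φᶜ) (fun h => h hτ), iv_of_mem hτ, MonModule.zero_add]
      simp only [wlpApprox_succ_wloop_of_mem f _ hτ]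
      exact isInf_wlpApprox_seq hco htop hL (hC L τ)
    · rw [iv_of_mem hτ, iv_of_notMem hτ, mm.add_zero]
      simp only [wlpApprox_succ_wloop_of_notMem f _ hτ]
      exact isInf_const _
  · induction n generalizing τ with
    | zero => exact htop _
    | succ n ih =>
      rw [← congrFun hY τ]
      by_cases hτ : τ ∈ φ
      · simp only [iv_of_notMem (φ := φᶜ) (fun h => h hτ), iv_of_mem hτ, MonModule.zero_add,
          wlpApprox_succ_wloop_of_mem f _ hτ]
        exact le_trans ((hC Y τ).1 n) (le_trans (wlpApprox_mono ih n _)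
          (wlpApprox_le_seq htop f C _ τ n.le_refl))
      · simp only [iv_of_mem (φ := φᶜ) hτ, iv_of_notMem hτ, mm.add_zero,
          wlpApprox_succ_wloop_of_notMem f _ hτ]
        exact le_refl _

theorem isInf_wlpApprox (hord : mm.NaturallyOrdered) (hco : OmegaCocontinuous mm)
    (htop : ∀ a, mm.le a top) (C : WGCL M St) (f : St → S) (σ : St) :
    mm.IsInf (fun n => wlpApprox mm top f n (some C, σ)) (wlp mm C f σ) := by
  induction C generalizing f σ with
  | assign g =>
    refine IsInf.of_succ (wlpApprox_dchain htop f _) ?_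
    simp only [wlpApprox_succ, WGCL.succs, finListSum_singleton, mm.one_smul, wlpApprox_none, wlp]
    exact isInf_const _
  | weight a =>
    refine IsInf.of_succ (wlpApprox_dchain htop f _) ?_
    simp only [wlpApprox_succ, WGCL.succs, finListSum_singleton, wlpApprox_none, wlp]
    exact isInf_const _
  | seq C₁ C₂ ih₁ ih₂ => exact isInf_wlpApprox_seq hco htop (ih₂ f) (ih₁ _ σ)
  | ite φ C₁ C₂ ih₁ ih₂ =>
    refine IsInf.of_succ (wlpApprox_dchain htop f _) ?_
    by_cases hσ : σ ∈ φ
    · simp only [wlpApprox_succ, WGCL.succs, if_pos hσ, finListSum_singleton, mm.one_smul, wlp,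
        iv_of_mem hσ, iv_of_notMem (φ := φᶜ) (fun h => h hσ), mm.add_zero]
      exact ih₁ f σ
    · simp only [wlpApprox_succ, WGCL.succs, if_neg hσ, finListSum_singleton, mm.one_smul, wlp,
        iv_of_notMem hσ, iv_of_mem (φ := φᶜ) hσ, MonModule.zero_add]
      exact ih₂ f σ
  | branch C₁ C₂ ih₁ ih₂ =>
    refine IsInf.of_succ (wlpApprox_dchain htop f _) ?_
    simp only [wlpApprox_succ, WGCL.succs, finListSum_pair, mm.one_smul, wlp]
    exact IsInf.add hco (wlpApprox_dchain htop f _) (wlpApprox_dchain htop f _) (ih₁ f σ)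
      (ih₂ f σ)
  | wloop φ C ih => exact isInf_wlpApprox_wloop hord hco htop φ ih f σ

theorem wlpApprox_zero_le_paths (htop : ∀ a, mm.le a top) (n : ℕ) (c : Conf M St) :
    mm.le (wlpApprox mm top (fun _ => mm.zero) n c)
      (finListSum mm (fun l => mm.smul (pathWeight l) top) (Conf.paths n c)) := by
  induction n generalizing c with
  | zero =>
    rw [Conf.paths, finListSum_singleton, pathWeight, List.map_nil, List.prod_nil, mm.one_smul]
    exact htop _
  | succ n ih =>
    obtain ⟨_ | C, σ⟩ := c
    · rw [wlpApprox_none]; exact zero_le _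
    · rw [finListSum_paths_succ, wlpApprox_succ]
      exact finListSum_mono (fun p : M × Conf M St => smul_le_smul _ (ih p.2)) _

theorem paths_succ_le_wlpApprox_zero (htop : ∀ a, mm.le a top) (n : ℕ) (c : Conf M St) :
    mm.le (finListSum mm (fun l => mm.smul (pathWeight l) top) (Conf.paths (n + 1) c))
      (wlpApprox mm top (fun _ => mm.zero) n c) := by
  induction n generalizing c with
  | zero =>
    obtain ⟨_ | C, σ⟩ := c
    · exact le_refl _
    · exact htop _
  | succ n ih =>
    obtain ⟨_ | C, σ⟩ := c
    · rw [wlpApprox_none]; exact le_refl _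
    · rw [finListSum_paths_succ, wlpApprox_succ]
      exact finListSum_mono (fun p : M × Conf M St => smul_le_smul _ (ih p.2)) _

end Approximations

/-- **Soundness of wlp**: for a naturally ordered ω-bicontinuous `M`-module `S`, every
program `C` and state `σ`, `wlp[C](𝟘)(σ) = ⨅_{n∈ℕ} ⨁_{π ∈ Paths_n(C,σ)} weight(π) ⊗ ⊤`,
where `Paths_n(C,σ)` are the computation paths of length exactly `n` from `(C,σ)`,
`⊤` is the greatest element of `S`, the inner sum is the countable module sum, and the
outer infimum is taken along `n`. -/
theorem wlp_soundness (M S St : Type) [Monoid M] [Countable St] (mm : MonModule M S)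
    (hord : mm.NaturallyOrdered) (hbi : OmegaBicontinuous mm) :
    ∀ (C : WGCL M St) (σ : St) (top : S), (∀ a : S, mm.le a top) →
      ∃ v : ℕ → S,
        (∀ n : ℕ,
          IsSumOver mm {l : List (M × Conf M St) | Steps (some C, σ) l ∧ l.length = n}
            (fun l => mm.smul (pathWeight l) top) (v n)) ∧
        mm.IsInf v (wlp mm C (fun _ => mm.zero) σ) := by
  intro C σ top htop
  have hinf := isInf_wlpApprox hord hbi.2 htop C (fun _ => mm.zero) σ
  refine ⟨fun n => finListSum mm (fun l => mm.smul (pathWeight l) top)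
    (Conf.paths n (some C, σ)), fun n => ?_, fun n => ?_, fun y hy => hinf.2 y fun n => ?_⟩
  · exact isSumOver_finListSum (fun l => smul_top_add_self hord htop _) fun l => Conf.mem_paths
  · exact MonModule.le_trans (hinf.1 n) (wlpApprox_zero_le_paths htop n _)
  · exact MonModule.le_trans (hy (n + 1)) (paths_succ_le_wlpApprox_zero htop n _)
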